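/- arXiv:2603.03711 — 2 statements merged into one kernel-verified Lean document; each statement's English description precedes it below -/
import Mathlib

section
/- Exact total variation of binary randomized response: for the binary randomized response mechanism with parameter ε ≥ 0, the total variation distance between the output distribution on input 0 and the output distribution on input 1 is exactly (e^ε − 1)/(e^ε + 1) = tanh(ε/2); hence the total variation bound under ε-LDP is tight for this mechanism. -/
/-- Binary randomized response with parameter `ε`: `rr ε v y = Pr[M(v) = y]`, reporting
the true bit with probability `e^ε / (e^ε + 1)` and the flipped bit with probability
`1 / (e^ε + 1)`. -/
noncomputable def rr (ε : ℝ) (v y : Bool) : ℝ :=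
  if y = v then Real.exp ε / (Real.exp ε + 1) else 1 / (Real.exp ε + 1)

/-- Exact total variation of binary randomized response: for `ε ≥ 0`, the total variation
distance between the output distributions on inputs `0` and `1`, i.e. the supremum (here:
greatest value) over sets `S ⊆ {0,1}` of `|P(S) - Q(S)|`, is exactly
`(e^ε - 1)/(e^ε + 1) = tanh(ε/2)`; hence the TV bound under `ε`-LDP is tight for this
mechanism. -/
theorem rr_tv_exact (ε : ℝ) (hε : 0 ≤ ε) :
    IsGreatest
      (Set.range fun S : Finset Bool =>
        |∑ y ∈ S, rr ε false y - ∑ y ∈ S, rr ε true y|)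
      ((Real.exp ε - 1) / (Real.exp ε + 1)) ∧
    (Real.exp ε - 1) / (Real.exp ε + 1) = Real.tanh (ε / 2) := by
  have hE : 1 ≤ Real.exp ε := Real.one_le_exp hε
  have hnonneg : 0 ≤ (Real.exp ε - 1) / (Real.exp ε + 1) :=
    div_nonneg (by linarith) (by linarith)
  have hdiff : Real.exp ε / (Real.exp ε + 1) - 1 / (Real.exp ε + 1) =
      (Real.exp ε - 1) / (Real.exp ε + 1) := (sub_div _ _ _).symm
  refine ⟨⟨⟨{false}, ?_⟩, ?_⟩, ?_⟩
  · simp only [Finset.sum_singleton, rr, if_true, Bool.false_eq_true, if_false, hdiff]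
    exact abs_of_nonneg hnonneg
  · rintro _ ⟨S, rfl⟩
    have hS : S = ∅ ∨ S = {false} ∨ S = {true} ∨ S = {false, true} := by
      revert S
      decide
    rcases hS with rfl | rfl | rfl | rfl <;> rw [abs_le] <;> constructor <;>
      simp [rr] <;> simp only [one_div] at hdiff <;> linarith
  · have hexp : Real.exp ε = Real.exp (ε / 2) * Real.exp (ε / 2) := by
      rw [← Real.exp_add, add_halves]
    rw [Real.tanh_eq_sinh_div_cosh, Real.sinh_eq, Real.cosh_eq, Real.exp_neg, hexp]
    field_simp
end

section
/- Optimality of the utility-aware budget allocation: let I be a nonempty finite index set, W : I → ℝ with W_i > 0 for all i, and ε_total > 0. The allocation ε*_i = ε_total · √W_i / (∑_{j ∈ I} √W_j) satisfies ε*_i > 0 and ∑_i ε*_i = ε_total, and it achieves the value ∑_i W_i/ε*_i = (∑_i √W_i)²/ε_total, which is the minimum of ∑_i W_i/ε_i over all feasible allocations (ε_i > 0, ∑_i ε_i = ε_total). -/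
/-- Optimality of the utility-aware budget allocation: for a nonempty finite index set `I`,
weights `W i > 0`, and total budget `ε_total > 0`, the allocation
`ε*_i = ε_total · √(W i) / ∑ j, √(W j)` is feasible (`ε*_i > 0`, `∑ i, ε*_i = ε_total`),
achieves the value `∑ i, W i / ε*_i = (∑ i, √(W i))² / ε_total`, and this value is the
minimum of `∑ i, W i / ε i` over all feasible allocations (`ε i > 0`,
`∑ i, ε i = ε_total`). -/
theorem optimal_budget_allocation {I : Type*} [Fintype I] [Nonempty I]
    (W : I → ℝ) (εtotal : ℝ) (hW : ∀ i, 0 < W i) (htotal : 0 < εtotal) :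
    (∀ i, 0 < εtotal * Real.sqrt (W i) / ∑ j, Real.sqrt (W j)) ∧
    (∑ i, εtotal * Real.sqrt (W i) / ∑ j, Real.sqrt (W j)) = εtotal ∧
    (∑ i, W i / (εtotal * Real.sqrt (W i) / ∑ j, Real.sqrt (W j)))
      = (∑ i, Real.sqrt (W i)) ^ 2 / εtotal ∧
    ∀ ε : I → ℝ, (∀ i, 0 < ε i) → (∑ i, ε i = εtotal) →
      (∑ i, W i / (εtotal * Real.sqrt (W i) / ∑ j, Real.sqrt (W j))) ≤ ∑ i, W i / ε i := by
  have hsqrt : ∀ i, 0 < Real.sqrt (W i) := fun i => Real.sqrt_pos.2 (hW i)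
  have hsum : 0 < ∑ j, Real.sqrt (W j) :=
    Finset.sum_pos (fun i _ => hsqrt i) Finset.univ_nonempty
  have hvalue : (∑ i, W i / (εtotal * Real.sqrt (W i) / ∑ j, Real.sqrt (W j)))
      = (∑ i, Real.sqrt (W i)) ^ 2 / εtotal := by
    have hterm : ∀ i, W i / (εtotal * Real.sqrt (W i) / ∑ j, Real.sqrt (W j))
        = Real.sqrt (W i) * ((∑ j, Real.sqrt (W j)) / εtotal) := by
      intro i
      have hi := (hsqrt i).ne'
      have hs := hsum.ne'
      field_simp
      exact (Real.sq_sqrt (hW i).le).symm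
    rw [Finset.sum_congr rfl fun i _ => hterm i, ← Finset.sum_mul]
    ring
  refine ⟨fun i => div_pos (mul_pos htotal (hsqrt i)) hsum, ?_, hvalue, ?_⟩
  · rw [← Finset.sum_div, ← Finset.mul_sum, mul_div_cancel_right₀ _ hsum.ne']
  · intro ε hε hεsum
    rw [hvalue, ← hεsum]
    refine (Finset.sq_sum_div_le_sum_sq_div Finset.univ _ fun i _ => hε i).trans_eq ?_
    exact Finset.sum_congr rfl fun i _ => by rw [Real.sq_sqrt (hW i).le]
end
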